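/- There are exactly (q+1)²·q⁵ cyclic submodules of ²T₃(q) that are not free and are not contained in any free cyclic submodule of ²T₃(q) generated by a non-unimodular pair. -/

import Mathlib

open Matrix

/-- `Mat n F` is the type of `n × n` matrices over `F`. -/
abbrev Mat (n : ℕ) (F : Type) : Type := Matrix (Fin n) (Fin n) F

/-- A matrix is lower triangular (i.e. belongs to the ring `T_n(q)`)
if all entries above the diagonal vanish. -/
def LowerTri {n : ℕ} {F : Type} [Zero F] (X : Mat n F) : Prop :=
  ∀ i j : Fin n, i < j → X i j = 0

/-- The cyclic left submodule `T_n(q)(X,Y)` of `²T_n(q)` generated by the pair `(X,Y)`. -/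
def cyc {n : ℕ} {F : Type} [Field F] (X Y : Mat n F) : Set (Mat n F × Mat n F) :=
  {p | ∃ A : Mat n F, LowerTri A ∧ p = (A * X, A * Y)}

/-- The pair `(X,Y)` generates a *free* cyclic submodule:
`A • (X,Y) = (0,0)` with `A ∈ T_n(q)` forces `A = 0`. -/
def IsFreePair {n : ℕ} {F : Type} [Field F] (X Y : Mat n F) : Prop :=
  ∀ A : Mat n F, LowerTri A → A * X = 0 → A * Y = 0 → A = 0

/-- A pair `(X,Y)` is unimodular if for every index `i` one of the `i`-th
diagonal entries of `X`, `Y` is nonzero. -/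
def Unimodular {n : ℕ} {F : Type} [Field F] (X Y : Mat n F) : Prop :=
  ∀ i : Fin n, X i i ≠ 0 ∨ Y i i ≠ 0

/-- `M` is a free cyclic submodule of `²T_n(q)`. -/
def IsFreeCyc {n : ℕ} {F : Type} [Field F] (M : Set (Mat n F × Mat n F)) : Prop :=
  ∃ X Y : Mat n F, LowerTri X ∧ LowerTri Y ∧ IsFreePair X Y ∧ M = cyc X Y

/-- `M` is a free cyclic submodule of `²T_n(q)` generated by a non-unimodular pair. -/
def IsNonUnimodFreeCyc {n : ℕ} {F : Type} [Field F] (M : Set (Mat n F × Mat n F)) : Prop :=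
  ∃ X Y : Mat n F, LowerTri X ∧ LowerTri Y ∧ ¬ Unimodular X Y ∧ IsFreePair X Y ∧ M = cyc X Y

section General

variable {n : ℕ} {F : Type} [Field F]

lemma lowerTri_iff_blockTriangular {A : Mat n F} :
    LowerTri A ↔ A.BlockTriangular OrderDual.toDual :=
  Iff.rfl

lemma LowerTri.mul {A B : Mat n F} (hA : LowerTri A) (hB : LowerTri B) : LowerTri (A * B) :=
  Matrix.BlockTriangular.mul (lowerTri_iff_blockTriangular.1 hA) (lowerTri_iff_blockTriangular.1 hB)

lemma mem_cyc_self (X Y : Mat n F) : (X, Y) ∈ cyc X Y :=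
  ⟨1, fun _ _ h => Matrix.one_apply_ne h.ne, by simp⟩

lemma cyc_mul_subset {B : Mat n F} (hB : LowerTri B) (X Y : Mat n F) :
    cyc (B * X) (B * Y) ⊆ cyc X Y := by
  rintro _ ⟨A, hA, rfl⟩
  exact ⟨A * B, hA.mul hB, by simp [Matrix.mul_assoc]⟩

lemma cyc_mul {B : Mat n F} (hB : LowerTri B) (hdiag : ∀ i, B i i ≠ 0) (X Y : Mat n F) :
    cyc (B * X) (B * Y) = cyc X Y := by
  have hdet : IsUnit B.det := by
    rw [Matrix.det_of_isLowerTriangular B hB]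
    exact (Finset.prod_ne_zero_iff.2 fun i _ => hdiag i).isUnit
  have := B.invertibleOfIsUnitDet hdet
  have hinv : LowerTri B⁻¹ :=
    Matrix.blockTriangular_inv_of_blockTriangular (lowerTri_iff_blockTriangular.1 hB)
  refine (cyc_mul_subset hB X Y).antisymm ?_
  have h := cyc_mul_subset hinv (B * X) (B * Y)
  rwa [Matrix.nonsing_inv_mul_cancel_left _ _ hdet,
    Matrix.nonsing_inv_mul_cancel_left _ _ hdet] at h

end General

section Extension

variable {F : Type} [Field F]

/-- The `i`-th row of a pair of matrices, as a vector of pairs. -/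
def pairRow (X Y : Mat 3 F) (i : Fin 3) : Fin 3 → F × F := fun j => (X i j, Y i j)

/-- The vectors supported on the first `k` coordinates. -/
def headSpace (F : Type) [Field F] (k : ℕ) : Submodule F (Fin 3 → F × F) where
  carrier := {v | ∀ j : Fin 3, k ≤ j → v j = 0}
  add_mem' hv hw j hj := by simp [hv j hj, hw j hj]
  zero_mem' _ _ := rfl
  smul_mem' c v hv j hj := by simp [hv j hj]

lemma two_mul_le_finrank_headSpace {k : ℕ} (hk : k ≤ 3) :
    2 * k ≤ Module.finrank F (headSpace F k) := by
  let L : (Fin k → F × F) →ₗ[F] (Fin 3 → F × F) :=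
    { toFun := fun v j => if h : (j : ℕ) < k then v ⟨j, h⟩ else 0
      map_add' := fun v w => by ext j <;> by_cases h : (j : ℕ) < k <;> simp [h]
      map_smul' := fun c v => by ext j <;> by_cases h : (j : ℕ) < k <;> simp [h] }
  have hL : ∀ v, L v ∈ headSpace F k := fun v j hj => by
    simp [L, not_lt.2 hj]
  have hinj : Function.Injective (L.codRestrict _ hL) := by
    intro v w h
    funext i
    simpa [L] using congr_fun (congr_arg Subtype.val h) (Fin.castLE hk i)
  have h := LinearMap.finrank_le_finrank_of_injective hinj
  rwa [Module.finrank_pi_fintype, Finset.sum_const, Finset.card_univ, Fintype.card_fin,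
    Module.finrank_prod, Module.finrank_self, smul_eq_mul, mul_comm] at h

lemma exists_notMem_and_mem_sup {V : Type} [AddCommGroup V] [Module F V] {W U : Submodule F V}
    (h : ¬ W ≤ U) {v : V} (hv : v ∈ W) : ∃ w ∈ W, w ∉ U ∧ v ∈ U ⊔ Submodule.span F {w} := by
  by_cases hvU : v ∈ U
  · obtain ⟨w, hw, hwU⟩ := SetLike.not_le_iff_exists.1 h
    exact ⟨w, hw, hwU, Submodule.mem_sup_left hvU⟩
  · exact ⟨v, hv, hvU, Submodule.mem_sup_right (Submodule.mem_span_singleton_self v)⟩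

lemma not_le_span_of_card_lt_finrank {V : Type} [AddCommGroup V] [Module F V]
    [FiniteDimensional F V] {W : Submodule F V} {k : ℕ} (v : Fin k → V)
    (h : k < Module.finrank F W) : ¬ W ≤ Submodule.span F (Set.range v) := fun hle =>
  absurd ((Submodule.finrank_mono hle).trans (finrank_range_le_card v)) (by simpa using h)

lemma exists_free_extension (W : Fin 3 → Submodule F (Fin 3 → F × F))
    (hW : ∀ i : Fin 3, (i : ℕ) < Module.finrank F (W i)) {X Y : Mat 3 F}
    (h : ∀ i, pairRow X Y i ∈ W i) :
    ∃ X' Y' : Mat 3 F, (∀ i, pairRow X' Y' i ∈ W i) ∧ IsFreePair X' Y' ∧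
      cyc X Y ⊆ cyc X' Y' := by
  obtain ⟨u, huW, hu, hXu⟩ := exists_notMem_and_mem_sup
    (not_le_span_of_card_lt_finrank ![] (hW 0)) (h 0)
  obtain ⟨v, hvW, hv, hXv⟩ := exists_notMem_and_mem_sup
    (not_le_span_of_card_lt_finrank ![u] (hW 1)) (h 1)
  obtain ⟨w, hwW, hw, hXw⟩ := exists_notMem_and_mem_sup
    (not_le_span_of_card_lt_finrank ![u, v] (hW 2)) (h 2)
  simp only [Matrix.range_cons, Matrix.range_empty, Set.union_empty, Submodule.span_empty,
    bot_sup_eq, Submodule.mem_bot, Set.singleton_union, Submodule.mem_span_singleton,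
    Submodule.mem_span_pair, Submodule.mem_sup, exists_exists_eq_and, not_exists]
    at hu hXu hv hXv hw hXw
  obtain ⟨a, ha⟩ := hXu
  obtain ⟨b, c, hbc⟩ := hXv
  obtain ⟨_, ⟨d, e, rfl⟩, f, hf⟩ := hXw
  refine ⟨.of fun i j => (![u, v, w] i j).1, .of fun i j => (![u, v, w] i j).2, ?_, ?_, ?_⟩
  · intro i
    fin_cases i <;> assumption
  · intro A hA hAX hAY
    have hrow : ∀ i, A i 0 • u + A i 1 • v + A i 2 • w = 0 := by
      intro i
      ext j
      · simpa [Matrix.mul_apply, Fin.sum_univ_three] using congr_fun (congr_fun hAX i) j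
      · simpa [Matrix.mul_apply, Fin.sum_univ_three] using congr_fun (congr_fun hAY i) j
    have h2 : ∀ i, A i 2 = 0 := fun i => by
      by_contra hne
      refine hw (-(A i 2)⁻¹ * A i 0) (-(A i 2)⁻¹ * A i 1) ?_
      rw [mul_smul, mul_smul, ← smul_add, eq_neg_of_add_eq_zero_left (hrow i), smul_neg, neg_smul,
        neg_neg, inv_smul_smul₀ hne]
    have h1 : ∀ i, A i 1 = 0 := fun i => by
      by_contra hne
      refine hv (-(A i 1)⁻¹ * A i 0) ?_
      have := hrow i
      rw [h2, zero_smul, add_zero] at this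
      rw [mul_smul, eq_neg_of_add_eq_zero_left this, smul_neg, neg_smul,
        neg_neg, inv_smul_smul₀ hne]
    have h0 : ∀ i, A i 0 = 0 := fun i => by
      simpa [h1, h2, hu] using hrow i
    ext i j
    fin_cases j
    exacts [h0 i, h1 i, h2 i]
  · have hB : LowerTri !![a, 0, 0; b, c, 0; d, e, f] := by
      intro i j hij
      fin_cases i <;> fin_cases j <;> first | rfl | simp at hij
    convert cyc_mul_subset hB _ _ using 2
    · ext i j
      fin_cases i
      · simpa [pairRow, Matrix.mul_apply, Fin.sum_univ_three] using
          congr_arg Prod.fst (congr_fun ha j).symm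
      · simpa [pairRow, Matrix.mul_apply, Fin.sum_univ_three] using
          congr_arg Prod.fst (congr_fun hbc j).symm
      · simpa [pairRow, Matrix.mul_apply, Fin.sum_univ_three] using
          congr_arg Prod.fst (congr_fun hf j).symm
    · ext i j
      fin_cases i
      · simpa [pairRow, Matrix.mul_apply, Fin.sum_univ_three] using
          congr_arg Prod.snd (congr_fun ha j).symm
      · simpa [pairRow, Matrix.mul_apply, Fin.sum_univ_three] using
          congr_arg Prod.snd (congr_fun hbc j).symm
      · simpa [pairRow, Matrix.mul_apply, Fin.sum_univ_three] using
          congr_arg Prod.snd (congr_fun hf j).symm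

lemma lowerTri_of_pairRow_mem {X Y : Mat 3 F}
    (h : ∀ i : Fin 3, pairRow X Y i ∈ headSpace F (i + 1)) :
    LowerTri X ∧ LowerTri Y :=
  ⟨fun i j hij => congr_arg Prod.fst (h i j hij), fun i j hij => congr_arg Prod.snd (h i j hij)⟩

lemma pairRow_mem_headSpace {X Y : Mat 3 F} (hX : LowerTri X) (hY : LowerTri Y) (i : Fin 3) :
    pairRow X Y i ∈ headSpace F (i + 1) :=
  fun j hj => Prod.ext (hX i j hj) (hY i j hj)

lemma headSpace_mono : Monotone (headSpace F) := fun _ _ hkl _ hv j hj => hv j (hkl.trans hj)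

/-- If the `i`-th diagonal entries vanish for some `i > 0`, then the submodule lies in a free
cyclic submodule generated by a pair with the same defect. -/
lemma exists_isNonUnimodFreeCyc {X Y : Mat 3 F} (hX : LowerTri X) (hY : LowerTri Y) {i : Fin 3}
    (hi : i ≠ 0) (hXi : X i i = 0) (hYi : Y i i = 0) :
    ∃ N, IsNonUnimodFreeCyc N ∧ cyc X Y ⊆ N := by
  have hlt : ∀ j : Fin 3, (j : ℕ) < Module.finrank F
      (headSpace F (if j = i then (j : ℕ) else j + 1)) := by
    intro j
    have := two_mul_le_finrank_headSpace (F := F) (k := if j = i then (j : ℕ) else j + 1)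
      (by split_ifs <;> omega)
    split_ifs at this ⊢ with hj
    · have : (j : ℕ) ≠ 0 := fun h => hi (hj ▸ Fin.ext h)
      omega
    · omega
  obtain ⟨X', Y', hrow, hfree, hsub⟩ := exists_free_extension _ hlt (X := X) (Y := Y) fun j => by
    split_ifs with hj
    · subst hj
      intro l hl
      rcases hl.eq_or_lt with h | h
      · obtain rfl := Fin.ext h
        exact Prod.ext hXi hYi
      · exact pairRow_mem_headSpace hX hY _ l h
    · exact pairRow_mem_headSpace hX hY j
  have hlow := lowerTri_of_pairRow_mem fun j => headSpace_mono (by split_ifs <;> omega) (hrow j)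
  have hdiag := hrow i i (by simp)
  refine ⟨_, ⟨X', Y', hlow.1, hlow.2, fun hU => ?_, hfree, rfl⟩, hsub⟩
  exact (hU i).elim (fun h => h (congr_arg Prod.fst hdiag)) (fun h => h (congr_arg Prod.snd hdiag))

end Extension

section FreePairs

variable {F : Type} [Field F]

lemma Unimodular.isFreePair {X Y : Mat 3 F} (hX : LowerTri X) (hY : LowerTri Y)
    (h : Unimodular X Y) : IsFreePair X Y := by
  intro A hA hAX hAY
  have hzero : ∀ i j, (∀ l, j < l → A i l = 0) → A i j = 0 := by
    intro i j hl
    have key : ∀ Z : Mat 3 F, LowerTri Z → A * Z = 0 → A i j * Z j j = 0 := by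
      intro Z hZ hAZ
      refine Eq.trans (Eq.symm ?_) (congr_fun (congr_fun hAZ i) j)
      rw [Matrix.mul_apply]
      refine Finset.sum_eq_single j (fun l _ hlj => ?_) (by simp)
      rcases lt_or_gt_of_ne hlj with hlt | hlt
      · rw [hZ l j hlt, mul_zero]
      · rw [hl l hlt, zero_mul]
    rcases h j with hj | hj
    · exact (mul_eq_zero.1 (key X hX hAX)).resolve_right hj
    · exact (mul_eq_zero.1 (key Y hY hAY)).resolve_right hj
  ext i j
  induction j using WellFoundedGT.induction with
  | ind j ih => exact hzero i j ih

lemma IsFreePair.diag_zero_ne {X Y : Mat 3 F} (hX : LowerTri X) (hY : LowerTri Y)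
    (h : IsFreePair X Y) : X 0 0 ≠ 0 ∨ Y 0 0 ≠ 0 := by
  by_contra! hzero
  have hrow : ∀ Z : Mat 3 F, LowerTri Z → Z 0 0 = 0 → Matrix.single 0 0 (1 : F) * Z = 0 := by
    intro Z hZ hZ0
    ext i j
    rcases eq_or_ne i 0 with rfl | hi
    · rcases eq_or_ne j 0 with rfl | hj
      · simp [hZ0]
      · simp [hZ 0 j (Fin.pos_of_ne_zero hj)]
    · simp [hi]
  have hE := h (Matrix.single 0 0 1) (fun i j hij => by
    rw [Matrix.single_apply_of_ne]
    rintro ⟨rfl, rfl⟩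
    exact lt_irrefl _ hij) (hrow X hX hzero.1) (hrow Y hY hzero.2)
  simpa using congr_fun (congr_fun hE 0) 0

lemma LowerTri.mul_apply_self {A B : Mat 3 F} (hA : LowerTri A) (hB : LowerTri B) (i : Fin 3) :
    (A * B) i i = A i i * B i i := by
  rw [Matrix.mul_apply]
  refine Finset.sum_eq_single i (fun j _ hj => ?_) (by simp)
  rcases lt_or_gt_of_ne hj with h | h
  · rw [hB j i h, mul_zero]
  · rw [hA i j h, zero_mul]

end FreePairs

section NormalForm

variable {F : Type} [Field F]

/-- The normalized representative of a point of the projective line `Option F`. -/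
def projPoint : Option F → F × F
  | none => (0, 1)
  | some a => (1, a)

/-- A vector complementary to `projPoint P`. -/
def projCompl : Option F → F × F
  | none => (1, 0)
  | some _ => (0, 1)

lemma exists_eq_smul_projPoint {v : F × F} (hv : v ≠ 0) :
    ∃ (u : F) (P : Option F), u ≠ 0 ∧ v = u • projPoint P := by
  obtain ⟨x, y⟩ := v
  by_cases hx : x = 0
  · subst hx
    exact ⟨y, none, fun h => hv (by simp [h]), by simp [projPoint]⟩
  · exact ⟨x, some (y / x), hx, by simp [projPoint, mul_div_cancel₀ _ hx]⟩

lemma exists_eq_smul_projPoint_add (P : Option F) (v : F × F) :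
    ∃ l e : F, v = l • projPoint P + e • projCompl P := by
  obtain ⟨x, y⟩ := v
  cases P with
  | none => exact ⟨y, x, by simp [projPoint, projCompl]⟩
  | some a => exact ⟨x, y - x * a, by simp [projPoint, projCompl]⟩

lemma projPoint_ne_zero (P : Option F) : projPoint P ≠ 0 := by
  cases P <;> simp [projPoint]

lemma eq_of_projPoint_eq_smul {P Q : Option F} {u : F} (h : projPoint P = u • projPoint Q) :
    u = 1 ∧ P = Q := by
  cases P <;> cases Q <;> simp [projPoint] at h ⊢ <;> grind

lemma eq_of_smul_projCompl_eq {P : Option F} {l e e' : F}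
    (h : e • projCompl P = l • projPoint P + e' • projCompl P) : l = 0 ∧ e = e' := by
  cases P <;> simp_all [projPoint, projCompl, eq_comm]

/-- The data of a normal form: the points of the projective line on the diagonal in rows two and
three, the first column of row two, and row three modulo row two. -/
abbrev NormalData (F : Type) : Type := (Option F × Option F) × (Fin 5 → F)

/-- The matrix obtained from normal form data by applying `π` (one of the two projections). -/
def normalMat (π : F × F →ₗ[F] F) (t : NormalData F) : Mat 3 F :=
  !![0, 0, 0;
    π (t.2 0, t.2 1), π (projPoint t.1.1), 0;
    π (t.2 2, t.2 3), π (t.2 4 • projCompl t.1.1), π (projPoint t.1.2)]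

/-- The cyclic submodule with the given normal form. -/
def normalCyc (t : NormalData F) : Set (Mat 3 F × Mat 3 F) :=
  cyc (normalMat (.fst F F F) t) (normalMat (.snd F F F) t)

lemma lowerTri_normalMat (π : F × F →ₗ[F] F) (t : NormalData F) : LowerTri (normalMat π t) := by
  intro i j hij
  fin_cases i <;> fin_cases j <;> first | rfl | simp at hij

lemma normalCyc_injective : Function.Injective (normalCyc (F := F)) := by
  rintro ⟨⟨P, S⟩, a⟩ ⟨⟨P', S'⟩, a'⟩ h
  obtain ⟨A, hA, hp⟩ : _ ∈ normalCyc ⟨⟨P', S'⟩, a'⟩ := h.subset (mem_cyc_self _ _)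
  rw [Prod.mk.injEq] at hp
  have entry := fun i j =>
    And.intro (congr_fun (congr_fun hp.1 i) j) (congr_fun (congr_fun hp.2 i) j)
  have h12 : A 1 2 = 0 := hA 1 2 (by decide)
  have h11 := entry 1 1
  have h10 := entry 1 0
  have h22 := entry 2 2
  have h21 := entry 2 1
  have h20 := entry 2 0
  simp only [normalMat, Matrix.mul_apply, Fin.sum_univ_three, Matrix.of_apply, Matrix.cons_val,
    h12, mul_zero, zero_mul, zero_add, add_zero, LinearMap.fst_apply, LinearMap.snd_apply]
    at h11 h10 h22 h21 h20
  obtain ⟨hA1, rfl⟩ := eq_of_projPoint_eq_smul (Prod.ext h11.1 h11.2)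
  obtain ⟨hA2, rfl⟩ := eq_of_projPoint_eq_smul (Prod.ext h22.1 h22.2)
  simp only [hA1, hA2, one_mul] at h10 h21 h20
  obtain ⟨hA21, h4⟩ := eq_of_smul_projCompl_eq (Prod.ext h21.1 h21.2)
  simp only [hA21, zero_mul, zero_add] at h20
  congr 1
  funext i
  fin_cases i
  exacts [h10.1, h10.2, h20.1, h20.2, h4]

lemma exists_eq_normalCyc {X Y : Mat 3 F} (hX : LowerTri X) (hY : LowerTri Y)
    (h0 : X 0 0 = 0 ∧ Y 0 0 = 0) (h1 : X 1 1 ≠ 0 ∨ Y 1 1 ≠ 0) (h2 : X 2 2 ≠ 0 ∨ Y 2 2 ≠ 0) :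
    ∃ t, cyc X Y = normalCyc t := by
  obtain ⟨u, P, hu, hP⟩ := exists_eq_smul_projPoint (v := (X 1 1, Y 1 1))
    (by simpa [Prod.ext_iff, imp_iff_not_or] using h1)
  obtain ⟨w, S, hw, hS⟩ := exists_eq_smul_projPoint (v := (X 2 2, Y 2 2))
    (by simpa [Prod.ext_iff, imp_iff_not_or] using h2)
  obtain ⟨l, e, hle⟩ := exists_eq_smul_projPoint_add P (X 2 1, Y 2 1)
  simp only [Prod.ext_iff, Prod.fst_add, Prod.snd_add, Prod.smul_fst, Prod.smul_snd,
    smul_eq_mul] at hP hS hle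
  let t : NormalData F := ((P, S), ![u⁻¹ * X 1 0, u⁻¹ * Y 1 0,
    w⁻¹ * (X 2 0 - l * (u⁻¹ * X 1 0)), w⁻¹ * (Y 2 0 - l * (u⁻¹ * Y 1 0)), w⁻¹ * e])
  let B : Mat 3 F := !![1, 0, 0; 0, u, 0; 0, l, w]
  have hB : LowerTri B := by
    intro i j hij
    fin_cases i <;> fin_cases j <;> first | rfl | simp at hij
  have hdiag : ∀ i, B i i ≠ 0 := by
    intro i
    fin_cases i
    exacts [one_ne_zero, hu, hw]
  have hX01 := hX 0 1 (by decide)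
  have hX02 := hX 0 2 (by decide)
  have hX12 := hX 1 2 (by decide)
  have hY01 := hY 0 1 (by decide)
  have hY02 := hY 0 2 (by decide)
  have hY12 := hY 1 2 (by decide)
  refine ⟨t, ?_⟩
  rw [normalCyc, ← cyc_mul hB hdiag (normalMat _ t)]
  congr 1
  · ext i j
    fin_cases i <;> fin_cases j <;>
      simp [normalMat, Matrix.mul_apply, Fin.sum_univ_three, mul_assoc, B, t, *]
  · ext i j
    fin_cases i <;> fin_cases j <;>
      simp [normalMat, Matrix.mul_apply, Fin.sum_univ_three, mul_assoc, B, t, *]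

lemma not_isFreeCyc_normalCyc (t : NormalData F) : ¬ IsFreeCyc (normalCyc t) := by
  rintro ⟨X, Y, hX, hY, hfree, h⟩
  obtain ⟨A, hA, hp⟩ : (X, Y) ∈ normalCyc t := h ▸ mem_cyc_self X Y
  rw [Prod.mk.injEq] at hp
  have h0 := hfree.diag_zero_ne hX hY
  rw [hp.1, hp.2, hA.mul_apply_self (lowerTri_normalMat _ t),
    hA.mul_apply_self (lowerTri_normalMat _ t)] at h0
  simp [normalMat] at h0

lemma not_normalCyc_subset (t : NormalData F) {N : Set (Mat 3 F × Mat 3 F)}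
    (hN : IsNonUnimodFreeCyc N) : ¬ normalCyc t ⊆ N := by
  obtain ⟨X, Y, hX, hY, hnon, hfree, rfl⟩ := hN
  intro hsub
  obtain ⟨A, hA, hp⟩ := hsub (mem_cyc_self _ _)
  rw [Prod.mk.injEq] at hp
  have key : ∀ i, (normalMat (.fst F F F) t i i, normalMat (.snd F F F) t i i) ≠ 0 →
      X i i ≠ 0 ∨ Y i i ≠ 0 := by
    intro i
    contrapose!
    rintro ⟨hXi, hYi⟩
    rw [hp.1, hp.2, hA.mul_apply_self hX, hA.mul_apply_self hY, hXi, hYi, mul_zero]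
    rfl
  refine hnon fun i => ?_
  fin_cases i
  exacts [hfree.diag_zero_ne hX hY, key 1 (projPoint_ne_zero t.1.1), key 2 (projPoint_ne_zero t.1.2)]

end NormalForm

theorem stmt_15 (q : ℕ) (hq : 2 ≤ q)
    (F : Type) [Field F] [Fintype F] (hF : Fintype.card F = q) :
    Set.ncard {M : Set (Mat 3 F × Mat 3 F) |
        (∃ X Y : Mat 3 F, LowerTri X ∧ LowerTri Y ∧ M = cyc X Y) ∧
        ¬ IsFreeCyc M ∧
        ∀ N : Set (Mat 3 F × Mat 3 F), IsNonUnimodFreeCyc N → ¬ M ⊆ N}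
      = (q + 1) ^ 2 * q ^ 5 := by
  have hrange : {M : Set (Mat 3 F × Mat 3 F) |
        (∃ X Y : Mat 3 F, LowerTri X ∧ LowerTri Y ∧ M = cyc X Y) ∧
        ¬ IsFreeCyc M ∧
        ∀ N : Set (Mat 3 F × Mat 3 F), IsNonUnimodFreeCyc N → ¬ M ⊆ N}
      = Set.range (normalCyc (F := F)) := by
    ext M
    constructor
    · rintro ⟨⟨X, Y, hX, hY, rfl⟩, hfree, hN⟩
      have hdiag : ∀ i : Fin 3, i ≠ 0 → X i i ≠ 0 ∨ Y i i ≠ 0 := by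
        intro i hi
        by_contra! h
        obtain ⟨N, hNN, hsub⟩ := exists_isNonUnimodFreeCyc hX hY hi h.1 h.2
        exact hN N hNN hsub
      have h0 : X 0 0 = 0 ∧ Y 0 0 = 0 := by
        by_contra! h
        refine hfree ⟨X, Y, hX, hY, Unimodular.isFreePair hX hY fun i => ?_, rfl⟩
        rcases eq_or_ne i 0 with rfl | hi
        · exact or_iff_not_imp_left.2 fun hx => h (not_not.1 hx)
        · exact hdiag i hi
      obtain ⟨t, ht⟩ := exists_eq_normalCyc hX hY h0 (hdiag 1 (by decide)) (hdiag 2 (by decide))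
      exact ⟨t, ht.symm⟩
    · rintro ⟨t, rfl⟩
      exact ⟨⟨_, _, lowerTri_normalMat _ t, lowerTri_normalMat _ t, rfl⟩,
        not_isFreeCyc_normalCyc t, fun N hN => not_normalCyc_subset t hN⟩
  rw [hrange, ← Set.image_univ, Set.ncard_image_of_injective _ normalCyc_injective,
    Set.ncard_univ, Nat.card_eq_fintype_card]
  simp [hF, sq]
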